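/- Let G be an interval graph and S, S' distinct c-colorable sets of size at least k in G. Then there is a TAR(k)-reconfiguration sequence between S and S' if and only if neither S nor S' is locked in G (i.e., neither is a maximal c-colorable set of G of size exactly k). -/

import Mathlib

open Finset

variable {V : Type*}

/-- `S` is a `c`-colorable vertex set in `G`. -/
def ColSet (G : SimpleGraph V) (c : ℕ) (S : Finset V) : Prop :=
  (G.induce (S : Set V)).Colorable c

/-- One TAR(k) step between `c`-colorable sets. -/
def TARStep (G : SimpleGraph V) (c k : ℕ) [DecidableEq V] (A B : Finset V) : Prop :=
  ColSet G c A ∧ ColSet G c B ∧ k ≤ A.card ∧ k ≤ B.card ∧ (symmDiff A B).card = 1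

/-- One TJ step between `c`-colorable sets. -/
def TJStep (G : SimpleGraph V) (c : ℕ) [DecidableEq V] (A B : Finset V) : Prop :=
  ColSet G c A ∧ ColSet G c B ∧ (A \ B).card = 1 ∧ (B \ A).card = 1

/-- `l` is a TAR(k)-reconfiguration sequence from `S` to `S'`. -/
def TARSeq (G : SimpleGraph V) (c k : ℕ) [DecidableEq V] (S S' : Finset V)
    (l : List (Finset V)) : Prop :=
  l.head? = some S ∧ l.getLast? = some S' ∧ l.Chain' (TARStep G c k)

def TJSeq (G : SimpleGraph V) (c : ℕ) [DecidableEq V] (S S' : Finset V)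
    (l : List (Finset V)) : Prop :=
  l.head? = some S ∧ l.getLast? = some S' ∧ l.Chain' (TJStep G c)

def TARReach (G : SimpleGraph V) (c k : ℕ) [DecidableEq V] (S S' : Finset V) : Prop :=
  ∃ l, TARSeq G c k S S' l

def TJReach (G : SimpleGraph V) (c : ℕ) [DecidableEq V] (S S' : Finset V) : Prop :=
  ∃ l, TJSeq G c S S' l

/-- Length of a shortest TAR(k)-sequence (number of steps), `⊤` if none exists. -/
noncomputable def TARDist (G : SimpleGraph V) (c k : ℕ) [DecidableEq V]
    (S S' : Finset V) : ℕ∞ :=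
  sInf {n : ℕ∞ | ∃ l, TARSeq G c k S S' l ∧ (l.length : ℕ∞) = n + 1}

noncomputable def TJDist (G : SimpleGraph V) (c : ℕ) [DecidableEq V]
    (S S' : Finset V) : ℕ∞ :=
  sInf {n : ℕ∞ | ∃ l, TJSeq G c S S' l ∧ (l.length : ℕ∞) = n + 1}

/-- `S` is a maximal `c`-colorable set among subsets of `U`, of size exactly `k`
(`S` is "locked" in `G[U]`). -/
def LockedIn (G : SimpleGraph V) (c k : ℕ) (U S : Finset V) : Prop :=
  S.card = k ∧ ColSet G c S ∧ S ⊆ U ∧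
    ∀ T ⊆ U, ColSet G c T → S ⊆ T → T = S

/-- `S` is locked in `G` itself. -/
def Locked [Fintype V] (G : SimpleGraph V) (c k : ℕ) (S : Finset V) : Prop :=
  LockedIn G c k Finset.univ S

/-- `G` is an interval graph. -/
def IsIntervalGraph (G : SimpleGraph V) : Prop :=
  ∃ l r : V → ℝ, (∀ v, l v ≤ r v) ∧
    ∀ u v, G.Adj u v ↔ u ≠ v ∧ max (l u) (l v) ≤ min (r u) (r v)

/-- `G` is perfect: every induced subgraph has chromatic number equal to its
clique number, stated via the colorability/clique-free characterization. -/
def IsPerfect (G : SimpleGraph V) : Prop :=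
  ∀ (S : Set V) (c : ℕ), (G.induce S).Colorable c ↔ (G.induce S).CliqueFree (c + 1)

/-- Elementary form of colorability. -/
theorem colSet_iff (G : SimpleGraph V) (c : ℕ) (S : Finset V) :
    ColSet G c S ↔ ∃ f : V → ℕ, (∀ v ∈ S, f v < c) ∧
      ∀ u ∈ S, ∀ v ∈ S, G.Adj u v → f u ≠ f v := by
  classical
  constructor
  · rintro ⟨C⟩
    refine ⟨fun v => if h : v ∈ S then (C ⟨v, by simpa using h⟩ : Fin c).val else 0, ?_, ?_⟩
    · intro v hv
      simp [hv]
    · intro u hu v hv huv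
      simp only [hu, hv, dif_pos]
      intro h
      have h2 : (G.induce (S : Set V)).Adj ⟨u, by simpa using hu⟩ ⟨v, by simpa using hv⟩ := by
        simpa using huv
      exact C.valid h2 (Fin.ext h)
  · rintro ⟨f, hf, hadj⟩
    refine ⟨SimpleGraph.Coloring.mk (fun v => ⟨f v.1, hf v.1 (by simpa using v.2)⟩) ?_⟩
    intro u v huv h
    have h3 : G.Adj u.1 v.1 := by simpa using huv
    exact hadj u.1 (by simpa using u.2) v.1 (by simpa using v.2) h3 (by simpa using h)

theorem colSet_mono (G : SimpleGraph V) (c : ℕ) {S T : Finset V} (h : S ⊆ T)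
    (hT : ColSet G c T) : ColSet G c S := by
  rw [colSet_iff] at *
  obtain ⟨f, h1, h2⟩ := hT
  exact ⟨f, fun v hv => h1 v (h hv), fun u hu v hv => h2 u (h hu) v (h hv)⟩

/-- In an interval graph, a set is colorable iff no point is covered more than `c` times. -/
theorem colSet_iff_cover (G : SimpleGraph V) (c : ℕ) (l r : V → ℝ)
    (hlr : ∀ v, l v ≤ r v)
    (hadj : ∀ u v, G.Adj u v ↔ u ≠ v ∧ max (l u) (l v) ≤ min (r u) (r v)) (S : Finset V) :
    ColSet G c S ↔ ∀ p : ℝ, (S.filter (fun v => l v ≤ p ∧ p ≤ r v)).card ≤ c := by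
  classical
  constructor
  · intro h p
    rw [colSet_iff] at h
    obtain ⟨f, h1, h2⟩ := h
    rw [← Finset.card_range c]
    apply Finset.card_le_card_of_injOn f
    · intro v hv
      simp at hv ⊢
      exact h1 v hv.1
    · intro u hu v hv huv
      simp at hu hv
      by_contra hne
      refine h2 u hu.1 v hv.1 ?_ huv
      rw [hadj]
      refine ⟨hne, ?_⟩
      exact le_trans (max_le hu.2.1 hv.2.1) (le_min hu.2.2 hv.2.2)
  · induction S using Finset.strongInduction with
    | H S ih =>
    intro h
    rcases S.eq_empty_or_nonempty with rfl | hne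
    · rw [colSet_iff]
      exact ⟨fun _ => 0, by simp, by simp⟩
    obtain ⟨v, hv, hmax⟩ := S.exists_max_image l hne
    have h1 := ih (S.erase v) (Finset.erase_ssubset hv) (fun p =>
      le_trans (Finset.card_le_card (Finset.filter_subset_filter _ (Finset.erase_subset _ _))) (h p))
    rw [colSet_iff] at h1 ⊢
    obtain ⟨f, hf1, hf2⟩ := h1
    set N := (S.erase v).filter (fun u => l u ≤ l v ∧ l v ≤ r u) with hN
    have hcard : (N.image f).card < (Finset.range c).card := by
      rw [Finset.card_range]
      refine lt_of_le_of_lt Finset.card_image_le (lt_of_lt_of_le ?_ (h (l v)))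
      apply Finset.card_lt_card
      rw [Finset.ssubset_iff_of_subset
        (Finset.filter_subset_filter _ (Finset.erase_subset _ _))]
      exact ⟨v, by simp [hv, hlr], by simp⟩
    obtain ⟨a, ha, haN⟩ := Finset.exists_mem_notMem_of_card_lt_card hcard
    have key : ∀ u ∈ S, G.Adj u v → f u ≠ a := by
      intro u hu huv hfa
      apply haN
      rw [Finset.mem_image]
      refine ⟨u, ?_, hfa⟩
      rw [hadj] at huv
      rw [hN, Finset.mem_filter, Finset.mem_erase]
      refine ⟨⟨huv.1, hu⟩, hmax u hu, ?_⟩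
      exact le_trans (le_max_right _ _) (le_trans huv.2 (min_le_left _ _))
    refine ⟨Function.update f v a, ?_, ?_⟩
    · intro u hu
      by_cases huv : u = v
      · subst huv; simpa using ha
      · rw [Function.update_of_ne huv]
        exact hf1 u (by simp [hu, huv])
    · intro u hu w hw huw
      by_cases huv : u = v
      · subst huv
        have : w ≠ u := huw.ne'
        rw [Function.update_self, Function.update_of_ne this]
        exact (key w hw huw.symm).symm
      · by_cases hwv : w = v
        · subst hwv
          rw [Function.update_self, Function.update_of_ne huv]
          exact key u hu huw
        · rw [Function.update_of_ne huv, Function.update_of_ne hwv]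
          exact hf2 u (by simp [hu, huv]) w (by simp [hw, hwv]) huw

theorem tarStep_symm (G : SimpleGraph V) (c k : ℕ) [DecidableEq V] {A B : Finset V}
    (h : TARStep G c k A B) : TARStep G c k B A := by
  obtain ⟨h1, h2, h3, h4, h5⟩ := h
  exact ⟨h2, h1, h4, h3, by rwa [symmDiff_comm]⟩

theorem rtg_symm (G : SimpleGraph V) (c k : ℕ) [DecidableEq V] {A B : Finset V}
    (h : Relation.ReflTransGen (TARStep G c k) A B) :
    Relation.ReflTransGen (TARStep G c k) B A := by
  induction h with
  | refl => exact .refl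
  | tail _ hs ih => exact .head (tarStep_symm G c k hs) ih

theorem tarReach_iff (G : SimpleGraph V) (c k : ℕ) [DecidableEq V] (A B : Finset V) :
    TARReach G c k A B ↔ Relation.ReflTransGen (TARStep G c k) A B := by
  constructor
  · rintro ⟨L, h1, h2, h3⟩
    induction L generalizing A with
    | nil => simp at h1
    | cons x xs ih =>
      simp at h1
      subst h1
      cases xs with
      | nil =>
        simp at h2
        subst h2
        exact .refl
      | cons y ys =>
        have h4 := List.isChain_cons_cons.1 h3
        exact .head h4.1 (ih y rfl (by simpa using h2) h4.2)
  · intro h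
    induction h using Relation.ReflTransGen.head_induction_on with
    | refl => exact ⟨[B], rfl, rfl, List.isChain_singleton _⟩
    | head hs _ ih =>
      obtain ⟨L, h1, h2, h3⟩ := ih
      cases L with
      | nil => simp at h1
      | cons x xs =>
        simp at h1
        subst h1
        exact ⟨_ :: x :: xs, rfl, by simpa using h2, List.isChain_cons_cons.2 ⟨hs, h3⟩⟩

theorem rtg_of_subset (G : SimpleGraph V) (c k : ℕ) [DecidableEq V] {A B : Finset V}
    (hAB : A ⊆ B) (hB : ColSet G c B) (hk : k ≤ A.card) :
    Relation.ReflTransGen (TARStep G c k) B A := by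
  induction B using Finset.strongInduction with
  | H B ih =>
  by_cases h : A = B
  · subst h; exact .refl
  obtain ⟨v, hvB, hvA⟩ := Finset.exists_of_ssubset (lt_of_le_of_ne hAB h)
  have hsub : A ⊆ B.erase v := by
    intro x hx
    rw [Finset.mem_erase]
    exact ⟨fun e => hvA (e ▸ hx), hAB hx⟩
  have hc := colSet_mono G c (Finset.erase_subset v B) hB
  refine .head ⟨hB, hc, hk.trans (Finset.card_le_card hAB),
    hk.trans (Finset.card_le_card hsub), ?_⟩ (ih _ (Finset.erase_ssubset hvB) hsub hc)
  rw [Finset.card_eq_one]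
  refine ⟨v, ?_⟩
  ext x
  simp only [Finset.mem_symmDiff, Finset.mem_erase, Finset.mem_singleton]
  by_cases hx : x = v
  · subst hx; simp [hvB]
  · simp [hx]

/-- The exchange step. -/
theorem exchange (G : SimpleGraph V) (c k : ℕ) [DecidableEq V] (l r : V → ℝ)
    (hlr : ∀ v, l v ≤ r v)
    (hadj : ∀ u v, G.Adj u v ↔ u ≠ v ∧ max (l u) (l v) ≤ min (r u) (r v))
    {A B : Finset V} (hA : ColSet G c A) (hB : ColSet G c B)
    (hcA : A.card = k + 1) (hcB : B.card = k + 1)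
    {v : V} (hv : v ∈ A \ B) (hmin : ∀ w ∈ B \ A, r v ≤ r w) :
    ∃ B', ColSet G c B' ∧ B'.card = k + 1 ∧ (A \ B').card < (A \ B).card ∧
      Relation.ReflTransGen (TARStep G c k) B B' := by
  rw [Finset.mem_sdiff] at hv
  have hne : (B \ A).Nonempty := by
    rw [Finset.sdiff_nonempty]
    intro h
    exact hv.2 ((Finset.eq_of_subset_of_card_le h (by omega)) ▸ hv.1)
  obtain ⟨w, hw, hwmin⟩ := (B \ A).exists_min_image l hne
  have hw' := Finset.mem_sdiff.1 hw
  have hvw : v ≠ w := fun e => hw'.2 (e ▸ hv.1)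
  have hvE : v ∉ B.erase w := fun h => hv.2 (Finset.mem_of_mem_erase h)
  have hcE : (B.erase w).card = k := by rw [Finset.card_erase_of_mem hw'.1]; omega
  have hcol : ColSet G c (insert v (B.erase w)) := by
    rw [colSet_iff_cover G c l r hlr hadj] at hA hB ⊢
    intro p
    by_cases hp : l v ≤ p ∧ p ≤ r v
    · by_cases hex : ∃ x ∈ B \ A, l x ≤ p ∧ p ≤ r x
      · obtain ⟨x, hx, hx1, hx2⟩ := hex
        have hwp : l w ≤ p ∧ p ≤ r w := ⟨(hwmin x hx).trans hx1, hp.2.trans (hmin w hw)⟩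
        have h1 : insert v ((B.erase w).filter (fun v => l v ≤ p ∧ p ≤ r v)) =
          (insert v (B.erase w)).filter (fun v => l v ≤ p ∧ p ≤ r v) := by
          rw [Finset.filter_insert, if_pos hp]
        rw [← h1, Finset.filter_erase]
        refine (Finset.card_insert_le _ _).trans ?_
        rw [Finset.card_erase_add_one (by simp [hw'.1, hwp])]
        exact hB p
      · refine le_trans (Finset.card_le_card ?_) (hA p)
        intro y hy
        rw [Finset.mem_filter, Finset.mem_insert, Finset.mem_erase] at hy
        rw [Finset.mem_filter]
        refine ⟨?_, hy.2⟩
        rcases hy.1 with rfl | h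
        · exact hv.1
        · by_contra hyA
          exact hex ⟨y, Finset.mem_sdiff.2 ⟨h.2, hyA⟩, hy.2⟩
    · rw [Finset.filter_insert, if_neg hp]
      exact le_trans (Finset.card_le_card
        (Finset.filter_subset_filter _ (Finset.erase_subset _ _))) (hB p)
  refine ⟨_, hcol, ?_, ?_, ?_⟩
  · rw [Finset.card_insert_of_notMem hvE, hcE]
  · apply Finset.card_lt_card
    rw [Finset.ssubset_iff_of_subset]
    · exact ⟨v, by simp [hv], by simp⟩
    · intro x hx
      simp only [Finset.mem_sdiff, Finset.mem_insert, Finset.mem_erase, not_or, not_and] at hx ⊢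
      refine ⟨hx.1, hx.2.2 ?_⟩
      rintro rfl
      exact hw'.2 hx.1
  · exact (rtg_of_subset G c k (Finset.erase_subset w B) hB hcE.ge).trans
      (rtg_symm G c k (rtg_of_subset G c k (Finset.subset_insert _ _) hcol hcE.ge))

theorem connected (G : SimpleGraph V) (hG : IsIntervalGraph G) (c k : ℕ) [DecidableEq V]
    (n : ℕ) : ∀ {A B : Finset V}, (A \ B).card ≤ n → ColSet G c A → ColSet G c B →
    A.card = k + 1 → B.card = k + 1 → Relation.ReflTransGen (TARStep G c k) A B := by
  obtain ⟨l, r, hlr, hadj⟩ := hG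
  induction n with
  | zero =>
    intro A B h hA hB hcA hcB
    have h0 : A ⊆ B := by
      rw [← Finset.sdiff_eq_empty_iff_subset, ← Finset.card_eq_zero]; omega
    rw [Finset.eq_of_subset_of_card_le h0 (by omega)]
  | succ n ih =>
    intro A B h hA hB hcA hcB
    have hBA : (B \ A).card = (A \ B).card := Finset.card_sdiff_comm (by omega)
    by_cases hne : (symmDiff A B).Nonempty
    · obtain ⟨v, hv, hmin⟩ := (symmDiff A B).exists_min_image r hne
      rcases Finset.mem_symmDiff.1 hv with hv | hv
      · obtain ⟨B', h1, h2, h3, h4⟩ := exchange G c k l r hlr hadj hA hB hcA hcB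
          (Finset.mem_sdiff.2 hv)
          (fun w hw => hmin w (Finset.mem_symmDiff.2 (Or.inr (Finset.mem_sdiff.1 hw))))
        exact (ih (by omega) hA h1 hcA h2).trans (rtg_symm G c k h4)
      · obtain ⟨A', h1, h2, h3, h4⟩ := exchange G c k l r hlr hadj hB hA hcB hcA
          (Finset.mem_sdiff.2 hv)
          (fun w hw => hmin w (Finset.mem_symmDiff.2 (Or.inl (Finset.mem_sdiff.1 hw))))
        exact h4.trans (rtg_symm G c k (ih (by omega) hB h1 hcB h2))
    · rw [Finset.not_nonempty_iff_eq_empty] at hne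
      have : A = B := symmDiff_eq_bot.1 hne
      rw [this]

theorem not_locked_of_rtg [Fintype V] [DecidableEq V] (G : SimpleGraph V) (c k : ℕ)
    {A B : Finset V} (hne : A ≠ B) (h : Relation.ReflTransGen (TARStep G c k) A B) :
    ¬ Locked G c k A := by
  rcases h.cases_head with h | ⟨T, hs, _⟩
  · exact absurd h hne
  rintro ⟨hk, _, _, hmax⟩
  obtain ⟨_, hT, _, hkT, h1⟩ := hs
  have hTA : T ≠ A := by rintro rfl; simp at h1
  have hnot : ¬ A ⊆ T := fun hs => hTA (hmax T (Finset.subset_univ _) hT hs)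
  have hnot2 : ¬ T ⊆ A := fun hs => hTA (Finset.eq_of_subset_of_card_le hs (by omega))
  obtain ⟨x, hx, hx2⟩ := Finset.not_subset.1 hnot
  obtain ⟨y, hy, hy2⟩ := Finset.not_subset.1 hnot2
  have := Finset.card_le_one.1 h1.le x (by simp [Finset.mem_symmDiff, hx, hx2])
    y (by simp [Finset.mem_symmDiff, hy, hy2])
  exact hx2 (this ▸ hy)

theorem exists_succ [Fintype V] [DecidableEq V] (G : SimpleGraph V) (c k : ℕ)
    {A : Finset V} (hA : ColSet G c A) (hk : k ≤ A.card) (hL : ¬ Locked G c k A) :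
    ∃ B, ColSet G c B ∧ B.card = k + 1 ∧ Relation.ReflTransGen (TARStep G c k) A B := by
  rcases hk.eq_or_lt with h | h
  · have : ∃ T, ColSet G c T ∧ A ⊆ T ∧ T ≠ A := by
      by_contra hcon
      push Not at hcon
      exact hL ⟨h.symm, hA, Finset.subset_univ _, fun T _ h1 h2 => hcon T h1 h2⟩
    obtain ⟨T, hT, hAT, hneT⟩ := this
    obtain ⟨v, hvT, hvA⟩ := Finset.exists_of_ssubset (lt_of_le_of_ne hAT hneT.symm)
    have hc : ColSet G c (insert v A) :=
      colSet_mono G c (Finset.insert_subset hvT hAT) hT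
    exact ⟨_, hc, by rw [Finset.card_insert_of_notMem hvA, h],
      rtg_symm G c k (rtg_of_subset G c k (Finset.subset_insert _ _) hc hk)⟩
  · obtain ⟨B, hBA, hcB⟩ := Finset.exists_subset_card_eq (Nat.succ_le_of_lt h)
    exact ⟨B, colSet_mono G c hBA hA, hcB, rtg_of_subset G c k hBA hA (by omega)⟩

theorem interval_reachable_iff_not_locked {V : Type*} [Fintype V] [DecidableEq V]
    (G : SimpleGraph V) (hG : IsIntervalGraph G) (c k : ℕ) (S S' : Finset V)
    (hne : S ≠ S') (hS : ColSet G c S) (hS' : ColSet G c S')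
    (hk : k ≤ S.card) (hk' : k ≤ S'.card) :
    TARReach G c k S S' ↔ ¬ Locked G c k S ∧ ¬ Locked G c k S' := by
  rw [tarReach_iff]
  constructor
  · intro h
    exact ⟨not_locked_of_rtg G c k hne h, not_locked_of_rtg G c k hne.symm (rtg_symm G c k h)⟩
  · rintro ⟨h1, h2⟩
    obtain ⟨A, hA, hcA, hrA⟩ := exists_succ G c k hS hk h1
    obtain ⟨B, hB, hcB, hrB⟩ := exists_succ G c k hS' hk' h2
    exact (hrA.trans (connected G hG c k _ le_rfl hA hB hcA hcB)).trans (rtg_symm G c k hrB)
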